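/- arXiv:cond-mat/0607615 — 2 statements merged into one kernel-verified Lean document; each statement's English description precedes it below -/
import Mathlib

section
/- Define the cavity function Ψ(t) = E[ln ω_β( Σ_{σ∈{−1,1}^N} exp(√(t/(NM)) Σ_{i=1}^N Σ_{k=1}^M J̃_{ik} τ_k σ_i) )], where ω_β is the normalized Gibbs average over τ ∈ {−1,1}^M with weights ξ_τ. Then for every t > 0, Ψ is differentiable at t and Ψ'(t) = (1/2)(1 − ⟨q_{12}q̃_{12}⟩_t). -/
open MeasureTheory ProbabilityTheory Filter

noncomputable section

/-- spin value of a Boolean configuration coordinate: `±1`. -/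
def spinval (b : Bool) : ℝ := if b then 1 else -1

/-- Joint law of the two independent i.i.d. standard Gaussian families `(Ĵ, J̃)`. -/
def couplingLaw (N M : ℕ) :
    Measure (((Fin M × Fin M) → ℝ) × ((Fin N × Fin M) → ℝ)) :=
  (Measure.pi fun _ : Fin M × Fin M => gaussianReal 0 1).prod
    (Measure.pi fun _ : Fin N × Fin M => gaussianReal 0 1)

/-- Random Gibbs weight on a pair `(σ, τ)`:
`ξ_τ · exp(√(t/(NM)) Σ_{i,k} J̃_{ik} τ_k σ_i)` with
`ξ_τ = exp((β/√M) Σ_{k,l} Ĵ_{kl} τ_k τ_l)`. -/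
def cavityWeight (N M : ℕ) (β t : ℝ)
    (J : ((Fin M × Fin M) → ℝ) × ((Fin N × Fin M) → ℝ))
    (στ : (Fin N → Bool) × (Fin M → Bool)) : ℝ :=
  Real.exp ((β / Real.sqrt M) * ∑ k : Fin M, ∑ l : Fin M,
      J.1 (k, l) * spinval (στ.2 k) * spinval (στ.2 l)
    + Real.sqrt (t / ((N : ℝ) * (M : ℝ))) * ∑ i : Fin N, ∑ k : Fin M,
      J.2 (i, k) * spinval (στ.2 k) * spinval (στ.1 i))

/-- Partition function of the cavity Gibbs measure. -/
def cavityZ (N M : ℕ) (β t : ℝ)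
    (J : ((Fin M × Fin M) → ℝ) × ((Fin N × Fin M) → ℝ)) : ℝ :=
  ∑ στ : (Fin N → Bool) × (Fin M → Bool), cavityWeight N M β t J στ

/-- Quenched replicated Gibbs average `⟨f⟩_t = E[Ω_t(f)]` over `n` replicas. -/
def replicaAvg (n N M : ℕ) (β t : ℝ)
    (f : (Fin n → (Fin N → Bool) × (Fin M → Bool)) → ℝ) : ℝ :=
  ∫ J, (∑ R : Fin n → (Fin N → Bool) × (Fin M → Bool),
      (∏ a : Fin n, cavityWeight N M β t J (R a)) * f R) / (cavityZ N M β t J) ^ n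
    ∂(couplingLaw N M)

/-- Overlap `(1/N) Σ_i σ_i σ'_i` of two spin configurations. -/
def ovlp (N : ℕ) (σ σ' : Fin N → Bool) : ℝ :=
  (1 / (N : ℝ)) * ∑ i : Fin N, spinval (σ i) * spinval (σ' i)

/-- The cavity function
`Ψ(t) = E[ln ω_β(Σ_σ exp(√(t/(NM)) Σ_{i,k} J̃_{ik} τ_k σ_i))]`. -/
def cavityPsi (N M : ℕ) (β t : ℝ) : ℝ :=
  ∫ J, Real.log
      ((∑ τ : Fin M → Bool,
          Real.exp ((β / Real.sqrt M) * ∑ k : Fin M, ∑ l : Fin M,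
            J.1 (k, l) * spinval (τ k) * spinval (τ l)) *
          ∑ σ : Fin N → Bool,
            Real.exp (Real.sqrt (t / ((N : ℝ) * (M : ℝ))) *
              ∑ i : Fin N, ∑ k : Fin M, J.2 (i, k) * spinval (τ k) * spinval (σ i))) /
        ∑ τ : Fin M → Bool,
          Real.exp ((β / Real.sqrt M) * ∑ k : Fin M, ∑ l : Fin M,
            J.1 (k, l) * spinval (τ k) * spinval (τ l)))
    ∂(couplingLaw N M)

section GaussianIntegrationByParts

lemma hasDerivAt_gaussianPDFReal_zero_one (x : ℝ) :
    HasDerivAt (gaussianPDFReal 0 1) (-(x * gaussianPDFReal 0 1 x)) x := by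
  have h : HasDerivAt (fun y : ℝ => -(y - 0) ^ 2 / (2 * ((1 : NNReal) : ℝ))) (-x) x := by
    have := (((hasDerivAt_id x).sub_const 0).pow 2).neg.div_const (2 * ((1 : NNReal) : ℝ))
    refine this.congr_deriv ?_
    simp
    ring
  rw [gaussianPDFReal_def]
  refine (h.exp.const_mul _).congr_deriv ?_
  ring

lemma integrable_gaussianPDFReal_mul {f : ℝ → ℝ} (hf : Integrable f (gaussianReal 0 1)) :
    Integrable (fun x => gaussianPDFReal 0 1 x * f x) := by
  rw [gaussianReal_of_var_ne_zero 0 one_ne_zero,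
    integrable_withDensity_iff_integrable_smul' (measurable_gaussianPDF _ _)
      (ae_of_all _ fun _ => gaussianPDF_lt_top)] at hf
  simpa [toReal_gaussianPDF] using hf

/-- Gaussian integration by parts (Stein's identity) on the line. -/
lemma integral_id_mul_gaussianReal {h h' : ℝ → ℝ} (hd : ∀ x, HasDerivAt h (h' x) x)
    (hi : Integrable h (gaussianReal 0 1)) (hi' : Integrable h' (gaussianReal 0 1))
    (hxi : Integrable (fun x => x * h x) (gaussianReal 0 1)) :
    ∫ x, x * h x ∂(gaussianReal 0 1) = ∫ x, h' x ∂(gaussianReal 0 1) := by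
  rw [integral_gaussianReal_eq_integral_smul one_ne_zero,
    integral_gaussianReal_eq_integral_smul one_ne_zero]
  have key := integral_mul_deriv_eq_deriv_mul_of_integrable
    (u := h) (u' := h') (v := gaussianPDFReal 0 1)
    (v' := fun x => -(x * gaussianPDFReal 0 1 x)) (fun x _ => hd x)
    (fun x _ => hasDerivAt_gaussianPDFReal_zero_one x)
    ((integrable_gaussianPDFReal_mul hxi).neg.congr (ae_of_all _ fun x => by simp; ring))
    ((integrable_gaussianPDFReal_mul hi').congr (ae_of_all _ fun x => by simp; ring))
    ((integrable_gaussianPDFReal_mul hi).congr (ae_of_all _ fun x => by simp; ring))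
  simp only [smul_eq_mul]
  calc ∫ x, gaussianPDFReal 0 1 x * (x * h x)
      = -∫ x, h x * -(x * gaussianPDFReal 0 1 x) := by
        rw [← integral_neg]; congr 1; ext x; ring
    _ = ∫ x, gaussianPDFReal 0 1 x * h' x := by
        rw [key, neg_neg]; congr 1; ext x; ring

/-- Resampling one coordinate of a product probability measure leaves it invariant. -/
lemma measurePreserving_update_pi {ι : Type*} [Fintype ι] [DecidableEq ι] {X : ι → Type*}
    [∀ i, MeasurableSpace (X i)] (μ : ∀ i, Measure (X i)) [∀ i, IsProbabilityMeasure (μ i)]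
    (i : ι) :
    MeasurePreserving (fun p : (∀ j, X j) × X i => Function.update p.1 i p.2)
      ((Measure.pi μ).prod (μ i)) (Measure.pi μ) := by
  refine ⟨measurable_update', (Measure.pi_eq fun s hs => ?_).symm⟩
  rw [Measure.map_apply measurable_update' (MeasurableSet.univ_pi hs)]
  have hpre : (fun p : (∀ j, X j) × X i => Function.update p.1 i p.2) ⁻¹' Set.univ.pi s
      = Set.univ.pi (Function.update s i Set.univ) ×ˢ s i := by
    ext p
    simp only [Set.mem_preimage, Set.mem_univ_pi, Set.mem_prod]
    constructor
    · intro h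
      refine ⟨fun j => ?_, by simpa using h i⟩
      rcases eq_or_ne j i with rfl | hj
      · simp
      · simpa [hj] using h j
    · rintro ⟨h, hi⟩ j
      rcases eq_or_ne j i with rfl | hj
      · simpa using hi
      · simpa [hj] using h j
  rw [hpre, Measure.prod_prod, Measure.pi_pi, ← Finset.mul_prod_erase _ _ (Finset.mem_univ i),
    ← Finset.mul_prod_erase Finset.univ (fun j => μ j (s j)) (Finset.mem_univ i)]
  rw [Finset.prod_congr rfl (g := fun j => μ j (s j))]
  · simp [mul_comm]
  · intro j hj
    simp [Finset.ne_of_mem_erase hj]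

lemma integrable_id_gaussianReal : Integrable (fun x : ℝ => x) (gaussianReal 0 1) :=
  memLp_one_iff_integrable.1 (memLp_id_gaussianReal 1)

lemma integrable_eval_pi_gaussianReal {ι : Type*} [Fintype ι] (i : ι) :
    Integrable (fun g : ι → ℝ => g i) (Measure.pi fun _ : ι => gaussianReal 0 1) :=
  integrable_comp_eval (X := fun _ : ι => ℝ) (μ := fun _ : ι => gaussianReal 0 1)
    integrable_id_gaussianReal

/-- Integration by parts in one coordinate of a standard Gaussian vector. -/
lemma integral_eval_mul_pi_gaussianReal {ι : Type*} [Fintype ι] [DecidableEq ι] (i : ι)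
    {f f' : (ι → ℝ) → ℝ} {C C' : ℝ} (hf : Measurable f) (hf' : Measurable f')
    (hC : ∀ g, |f g| ≤ C) (hC' : ∀ g, |f' g| ≤ C')
    (hd : ∀ g y, HasDerivAt (fun z => f (Function.update g i z)) (f' (Function.update g i y)) y) :
    ∫ g, g i * f g ∂(Measure.pi fun _ : ι => gaussianReal 0 1)
      = ∫ g, f' g ∂(Measure.pi fun _ : ι => gaussianReal 0 1) := by
  have hmp := measurePreserving_update_pi (fun _ : ι => gaussianReal 0 1) i
  have hint : Integrable (fun g : ι → ℝ => g i * f g)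
      (Measure.pi fun _ : ι => gaussianReal 0 1) :=
    (integrable_eval_pi_gaussianReal i).mul_bdd hf.aestronglyMeasurable (ae_of_all _ hC)
  have hint' : Integrable f' (Measure.pi fun _ : ι => gaussianReal 0 1) :=
    .of_bound hf'.aestronglyMeasurable _ (ae_of_all _ hC')
  have hupd : ∀ g : ι → ℝ, Measurable (Function.update g i) := fun g => measurable_update g
  rw [← hmp.map_eq, integral_map hmp.measurable.aemeasurable
      (by rw [hmp.map_eq]; exact hint.aestronglyMeasurable),
    integral_map hmp.measurable.aemeasurable hf'.aestronglyMeasurable,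
    integral_prod
      (fun p : (ι → ℝ) × ℝ => Function.update p.1 i p.2 i * f (Function.update p.1 i p.2))
      (hmp.integrable_comp_of_integrable hint),
    integral_prod (fun p : (ι → ℝ) × ℝ => f' (Function.update p.1 i p.2))
      (hmp.integrable_comp_of_integrable hint')]
  congr 1
  ext g
  simp only [Function.update_self]
  exact integral_id_mul_gaussianReal (hd g)
    (.of_bound (hf.comp (hupd g)).aestronglyMeasurable _ (ae_of_all _ fun _ => hC _))
    (.of_bound (hf'.comp (hupd g)).aestronglyMeasurable _ (ae_of_all _ fun _ => hC' _))
    (integrable_id_gaussianReal.mul_bdd (hf.comp (hupd g)).aestronglyMeasurable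
      (ae_of_all _ fun _ => hC _))

end GaussianIntegrationByParts

section GibbsAverage

variable {S : Type*} [Fintype S]

/-- Normalized Gibbs average of `f` with log-weights `w`. -/
def gibbsAvg (w f : S → ℝ) : ℝ := (∑ s, Real.exp (w s) * f s) / ∑ s, Real.exp (w s)

lemma sum_exp_pos [Nonempty S] (w : S → ℝ) : 0 < ∑ s, Real.exp (w s) :=
  Finset.sum_pos (fun _ _ => Real.exp_pos _) Finset.univ_nonempty

lemma gibbsAvg_const [Nonempty S] (w : S → ℝ) (c : ℝ) : gibbsAvg w (fun _ => c) = c := by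
  rw [gibbsAvg, ← Finset.sum_mul, mul_div_cancel_left₀ _ (sum_exp_pos w).ne']

lemma gibbsAvg_const_mul (w f : S → ℝ) (c : ℝ) :
    gibbsAvg w (fun s => c * f s) = c * gibbsAvg w f := by
  simp only [gibbsAvg, mul_div_assoc', Finset.mul_sum]
  simp only [mul_left_comm]

lemma gibbsAvg_sum {ι : Type*} (I : Finset ι) (w : S → ℝ) (f : ι → S → ℝ) :
    gibbsAvg w (fun s => ∑ i ∈ I, f i s) = ∑ i ∈ I, gibbsAvg w (f i) := by
  simp only [gibbsAvg, Finset.mul_sum, ← Finset.sum_div]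
  rw [Finset.sum_comm]

lemma abs_gibbsAvg_le [Nonempty S] (w : S → ℝ) {f : S → ℝ} {C : ℝ} (hf : ∀ s, |f s| ≤ C) :
    |gibbsAvg w f| ≤ C := by
  rw [gibbsAvg, abs_div, abs_of_pos (sum_exp_pos w), div_le_iff₀ (sum_exp_pos w), Finset.mul_sum]
  refine (Finset.abs_sum_le_sum_abs _ _).trans (Finset.sum_le_sum fun s _ => ?_)
  rw [abs_mul, Real.abs_exp, mul_comm]
  exact mul_le_mul_of_nonneg_right (hf s) (Real.exp_pos _).le

lemma hasDerivAt_log_sum_exp [Nonempty S] {u : S → ℝ → ℝ} {u' : S → ℝ} {y : ℝ}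
    (hu : ∀ s, HasDerivAt (u s) (u' s) y) :
    HasDerivAt (fun z => Real.log (∑ s, Real.exp (u s z))) (gibbsAvg (fun s => u s y) u') y :=
  (HasDerivAt.fun_sum fun s _ => (hu s).exp).log (sum_exp_pos _).ne'

lemma hasDerivAt_gibbsAvg [Nonempty S] {u : S → ℝ → ℝ} {u' : S → ℝ} {y : ℝ} (f : S → ℝ)
    (hu : ∀ s, HasDerivAt (u s) (u' s) y) :
    HasDerivAt (fun z => gibbsAvg (fun s => u s z) f)
      (gibbsAvg (fun s => u s y) (fun s => u' s * f s)
        - gibbsAvg (fun s => u s y) u' * gibbsAvg (fun s => u s y) f) y := by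
  have hnum : HasDerivAt (fun z => ∑ s, Real.exp (u s z) * f s)
      (∑ s, Real.exp (u s y) * (u' s * f s)) y :=
    (HasDerivAt.fun_sum fun s _ => (hu s).exp.mul_const (f s)).congr_deriv
      (by simp only [mul_assoc])
  have hden : HasDerivAt (fun z => ∑ s, Real.exp (u s z)) (∑ s, Real.exp (u s y) * u' s) y :=
    HasDerivAt.fun_sum fun s _ => (hu s).exp
  have hpos := (sum_exp_pos fun s => u s y).ne'
  refine (hnum.div hden hpos).congr_deriv ?_
  simp only [gibbsAvg]
  field_simp

lemma abs_log_sum_exp_le [Nonempty S] (w : S → ℝ) :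
    |Real.log (∑ s, Real.exp (w s))| ≤ Real.log (Fintype.card S) + ∑ s, |w s| := by
  have hle : ∀ s, |w s| ≤ ∑ s, |w s| := fun s =>
    Finset.single_le_sum (f := fun s => |w s|) (fun _ _ => abs_nonneg _) (Finset.mem_univ s)
  have hcard : (1 : ℝ) ≤ Fintype.card S := by exact_mod_cast Fintype.card_pos
  have hlog := Real.log_nonneg hcard
  rw [abs_le]
  constructor
  · obtain ⟨s⟩ := ‹Nonempty S›
    have h : Real.exp (w s) ≤ ∑ s, Real.exp (w s) :=
      Finset.single_le_sum (f := fun s => Real.exp (w s)) (fun _ _ => (Real.exp_pos _).le)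
        (Finset.mem_univ s)
    have := Real.log_le_log (Real.exp_pos _) h
    rw [Real.log_exp] at this
    have := neg_abs_le (w s)
    have := hle s
    linarith
  · have h : ∑ s, Real.exp (w s) ≤ Fintype.card S * Real.exp (∑ s, |w s|) := by
      simpa using Finset.sum_le_card_nsmul Finset.univ (fun s => Real.exp (w s)) _
        fun s _ => Real.exp_le_exp.2 ((le_abs_self _).trans (hle s))
    have := Real.log_le_log (sum_exp_pos w) h
    rwa [Real.log_mul (by positivity) (Real.exp_pos _).ne', Real.log_exp] at this

lemma integrable_log_sum_exp [Nonempty S] {Ω : Type*} [MeasurableSpace Ω] {μ : Measure Ω}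
    [IsFiniteMeasure μ] {w : Ω → S → ℝ} (hw : ∀ s, Integrable (fun ω => w ω s) μ) :
    Integrable (fun ω => Real.log (∑ s, Real.exp (w ω s))) μ := by
  refine ((integrable_const (Real.log (Fintype.card S))).add
    (integrable_finsetSum Finset.univ fun s _ => (hw s).abs)).mono' ?_
    (ae_of_all _ fun ω => abs_log_sum_exp_le (w ω))
  exact (Finset.aemeasurable_fun_sum _ fun s _ =>
    (hw s).aemeasurable.exp).log.aestronglyMeasurable

lemma measurable_gibbsAvg {Ω : Type*} [MeasurableSpace Ω] {w f : Ω → S → ℝ}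
    (hw : ∀ s, Measurable fun ω => w ω s) (hf : ∀ s, Measurable fun ω => f ω s) :
    Measurable fun ω => gibbsAvg (w ω) (f ω) :=
  (Finset.measurable_fun_sum _ fun s _ => (hw s).exp.mul (hf s)).div
    (Finset.measurable_fun_sum _ fun s _ => (hw s).exp)

end GibbsAverage

section GaussianInteraction

variable {S ι Ω : Type*} [Fintype S] [Nonempty S] [Fintype ι] [MeasurableSpace Ω]

lemma integrable_gibbsAvg_sq (ν : Measure Ω) [IsProbabilityMeasure ν]
    {A : S → Ω → ℝ} (hA : ∀ s, Measurable (A s)) {x : S → ι → ℝ} (hx : ∀ s i, x s i * x s i = 1)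
    (r : ℝ) (i : ι) :
    Integrable (fun J : Ω × (ι → ℝ) =>
        gibbsAvg (fun s => A s J.1 + r * ∑ j, J.2 j * x s j) (fun s => x s i) ^ 2)
      (ν.prod (Measure.pi fun _ : ι => gaussianReal 0 1)) := by
  have hG : Measurable fun J : Ω × (ι → ℝ) =>
      gibbsAvg (fun s => A s J.1 + r * ∑ j, J.2 j * x s j) (fun s => x s i) :=
    measurable_gibbsAvg (fun s => by have := hA s; fun_prop) (fun s => measurable_const)
  refine .of_bound (hG.pow_const 2).aestronglyMeasurable 1 (ae_of_all _ fun J => ?_)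
  rw [Real.norm_eq_abs, abs_pow]
  exact pow_le_one₀ (abs_nonneg _)
    (abs_gibbsAvg_le _ fun s => by rw [abs_le_one_iff_mul_self_le_one, hx])

/-- For a Gibbs measure with random log-weights `A s ω + r ∑ i, g i * x s i`, where `g` is a
standard Gaussian vector and `x s i = ±1`, integration by parts in `g i`. -/
lemma integral_eval_mul_gibbsAvg (ν : Measure Ω) [IsProbabilityMeasure ν]
    {A : S → Ω → ℝ} (hA : ∀ s, Measurable (A s)) {x : S → ι → ℝ} (hx : ∀ s i, x s i * x s i = 1)
    (r : ℝ) (i : ι) :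
    ∫ J : Ω × (ι → ℝ), J.2 i * gibbsAvg (fun s => A s J.1 + r * ∑ j, J.2 j * x s j) (fun s => x s i)
        ∂(ν.prod (Measure.pi fun _ : ι => gaussianReal 0 1))
      = ∫ J : Ω × (ι → ℝ),
          r * (1 - gibbsAvg (fun s => A s J.1 + r * ∑ j, J.2 j * x s j) (fun s => x s i) ^ 2)
        ∂(ν.prod (Measure.pi fun _ : ι => gaussianReal 0 1)) := by
  classical
  have habs : ∀ s, |x s i| ≤ 1 := fun s => by
    rw [abs_le_one_iff_mul_self_le_one, hx]
  have hG : Measurable fun J : Ω × (ι → ℝ) =>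
      gibbsAvg (fun s => A s J.1 + r * ∑ j, J.2 j * x s j) (fun s => x s i) :=
    measurable_gibbsAvg (fun s => by have := hA s; fun_prop) (fun s => measurable_const)
  have hGle : ∀ J : Ω × (ι → ℝ),
      |gibbsAvg (fun s => A s J.1 + r * ∑ j, J.2 j * x s j) (fun s => x s i)| ≤ 1 :=
    fun J => abs_gibbsAvg_le _ habs
  have hG'le : ∀ J : Ω × (ι → ℝ),
      |r * (1 - gibbsAvg (fun s => A s J.1 + r * ∑ j, J.2 j * x s j) (fun s => x s i) ^ 2)|
        ≤ |r| := by
    intro J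
    rw [abs_mul]
    refine mul_le_of_le_one_right (abs_nonneg _) ?_
    have h1 := (sq_le_one_iff_abs_le_one _).2 (hGle J)
    rw [abs_of_nonneg (by linarith)]
    linarith [sq_nonneg
      (gibbsAvg (fun s => A s J.1 + r * ∑ j, J.2 j * x s j) (fun s => x s i))]
  have hev : Integrable (fun J : Ω × (ι → ℝ) => J.2 i)
      (ν.prod (Measure.pi fun _ : ι => gaussianReal 0 1)) :=
    (integrable_eval_pi_gaussianReal i).comp_snd ν
  have hG' := ((hG.pow_const 2).const_sub 1).const_mul r
  rw [integral_prod _ (hev.mul_bdd hG.aestronglyMeasurable (ae_of_all _ hGle)),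
    integral_prod _ (.of_bound hG'.aestronglyMeasurable _ (ae_of_all _ hG'le))]
  congr 1
  ext ω
  refine integral_eval_mul_pi_gaussianReal i (hG.comp measurable_prodMk_left)
    (hG'.comp measurable_prodMk_left) (fun g => hGle (ω, g)) (fun g => hG'le (ω, g)) fun g y => ?_
  have hu : ∀ s, HasDerivAt (fun z => A s ω + r * ∑ j, Function.update g i z j * x s j)
      (r * x s i) y := by
    intro s
    refine (((HasDerivAt.fun_sum (A' := fun j => (Pi.single i 1 : ι → ℝ) j * x s j)
      fun j _ => ?_).const_mul r).const_add (A s ω)).congr_deriv ?_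
    · exact (hasDerivAt_pi.1 (hasDerivAt_update g i y) j).mul_const _
    · simp [Pi.single_apply]
  refine (hasDerivAt_gibbsAvg (fun s => x s i) hu).congr_deriv ?_
  simp only [mul_assoc, hx, gibbsAvg_const_mul, gibbsAvg_const]
  ring

/-- Derivative in the interaction strength of the quenched free energy. -/
lemma hasDerivAt_integral_log_sum_exp (ν : Measure Ω) [IsProbabilityMeasure ν]
    {A : S → Ω → ℝ} (hA : ∀ s, Measurable (A s)) (hAi : ∀ s, Integrable (A s) ν)
    {x : S → ι → ℝ} (hx : ∀ s i, x s i * x s i = 1) {c : Ω → ℝ} (hc : Integrable c ν) (r : ℝ) :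
    HasDerivAt
      (fun r => ∫ J : Ω × (ι → ℝ),
          Real.log (∑ s, Real.exp (A s J.1 + r * ∑ j, J.2 j * x s j)) - c J.1
        ∂(ν.prod (Measure.pi fun _ : ι => gaussianReal 0 1)))
      (r * ∑ i, (1 - ∫ J : Ω × (ι → ℝ),
          gibbsAvg (fun s => A s J.1 + r * ∑ j, J.2 j * x s j) (fun s => x s i) ^ 2
        ∂(ν.prod (Measure.pi fun _ : ι => gaussianReal 0 1)))) r := by
  have habs : ∀ s i, |x s i| ≤ 1 := fun s i => by
    rw [abs_le_one_iff_mul_self_le_one, hx]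
  have hev : ∀ i, Integrable (fun J : Ω × (ι → ℝ) => J.2 i)
      (ν.prod (Measure.pi fun _ : ι => gaussianReal 0 1)) :=
    fun i => (integrable_eval_pi_gaussianReal i).comp_snd ν
  have hF : ∀ r, Integrable (fun J : Ω × (ι → ℝ) =>
      Real.log (∑ s, Real.exp (A s J.1 + r * ∑ j, J.2 j * x s j)) - c J.1)
      (ν.prod (Measure.pi fun _ : ι => gaussianReal 0 1)) := fun r =>
    (integrable_log_sum_exp fun s => ((hAi s).comp_fst _).add
      ((integrable_finsetSum _ fun j _ => (hev j).mul_const _).const_mul r)).sub (hc.comp_fst _)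
  have hw : ∀ s, Measurable fun J : Ω × (ι → ℝ) => A s J.1 + r * ∑ j, J.2 j * x s j :=
    fun s => by have := hA s; fun_prop
  have hG : ∀ i, Measurable fun J : Ω × (ι → ℝ) =>
      gibbsAvg (fun s => A s J.1 + r * ∑ j, J.2 j * x s j) (fun s => x s i) :=
    fun i => measurable_gibbsAvg hw fun s => measurable_const
  have hGle : ∀ i, ∀ J : Ω × (ι → ℝ),
      |gibbsAvg (fun s => A s J.1 + r * ∑ j, J.2 j * x s j) (fun s => x s i)| ≤ 1 :=
    fun i J => abs_gibbsAvg_le _ fun s => habs s i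
  have key := (hasDerivAt_integral_of_dominated_loc_of_deriv_le
    (μ := ν.prod (Measure.pi fun _ : ι => gaussianReal 0 1)) (x₀ := r) (s := Set.univ)
    (F := fun r (J : Ω × (ι → ℝ)) =>
      Real.log (∑ s, Real.exp (A s J.1 + r * ∑ j, J.2 j * x s j)) - c J.1)
    (F' := fun r (J : Ω × (ι → ℝ)) =>
      gibbsAvg (fun s => A s J.1 + r * ∑ j, J.2 j * x s j) (fun s => ∑ j, J.2 j * x s j))
    (bound := fun J => ∑ j, |J.2 j|)
    univ_mem (Eventually.of_forall fun r => (hF r).aestronglyMeasurable) (hF r)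
    (measurable_gibbsAvg hw fun s => by fun_prop).aestronglyMeasurable
    (ae_of_all _ fun J r' _ => abs_gibbsAvg_le _ fun s =>
      (Finset.abs_sum_le_sum_abs _ _).trans (Finset.sum_le_sum fun j _ => by
        rw [abs_mul]; exact mul_le_of_le_one_right (abs_nonneg _) (habs s j)))
    (integrable_finsetSum _ fun j _ => (hev j).abs)
    (ae_of_all _ fun J r' _ => (hasDerivAt_log_sum_exp fun s =>
      (((hasDerivAt_id r').mul_const _).const_add (A s J.1)).congr_deriv
        (one_mul _)).sub_const _)).2
  refine key.congr_deriv ?_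
  simp only [gibbsAvg_sum, gibbsAvg_const_mul]
  rw [integral_finsetSum _ fun i _ =>
    (hev i).mul_bdd (hG i).aestronglyMeasurable (ae_of_all _ (hGle i)), Finset.mul_sum]
  refine Finset.sum_congr rfl fun i _ => ?_
  rw [integral_eval_mul_gibbsAvg ν hA hx, integral_const_mul, integral_sub (integrable_const _)]
  · simp
  · exact integrable_gibbsAvg_sq ν hA hx r i

end GaussianInteraction

section Cavity

lemma spinval_mul_self (b : Bool) : spinval b * spinval b = 1 := by
  cases b <;> simp [spinval]

/-- The product `τ_k σ_i` of the two spins at a site pair. -/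
def spinPair {N M : ℕ} (στ : (Fin N → Bool) × (Fin M → Bool)) (p : Fin N × Fin M) : ℝ :=
  spinval (στ.2 p.2) * spinval (στ.1 p.1)

lemma spinPair_mul_self {N M : ℕ} (στ : (Fin N → Bool) × (Fin M → Bool)) (p : Fin N × Fin M) :
    spinPair στ p * spinPair στ p = 1 := by
  rw [spinPair, mul_mul_mul_comm, spinval_mul_self, spinval_mul_self, one_mul]

/-- The logarithm of the weight `ξ_τ`. -/
def logXi (M : ℕ) (β : ℝ) (τ : Fin M → Bool) (J : Fin M × Fin M → ℝ) : ℝ :=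
  (β / Real.sqrt M) * ∑ k : Fin M, ∑ l : Fin M, J (k, l) * spinval (τ k) * spinval (τ l)

lemma measurable_logXi (M : ℕ) (β : ℝ) (τ : Fin M → Bool) : Measurable (logXi M β τ) := by
  unfold logXi
  fun_prop

lemma integrable_logXi (M : ℕ) (β : ℝ) (τ : Fin M → Bool) :
    Integrable (logXi M β τ) (Measure.pi fun _ => gaussianReal 0 1) :=
  (integrable_finsetSum _ fun k _ => integrable_finsetSum _ fun l _ =>
    ((integrable_eval_pi_gaussianReal (k, l)).mul_const _).mul_const _).const_mul _

lemma sum_interaction_eq {N M : ℕ} (g : Fin N × Fin M → ℝ)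
    (στ : (Fin N → Bool) × (Fin M → Bool)) :
    ∑ i : Fin N, ∑ k : Fin M, g (i, k) * spinval (στ.2 k) * spinval (στ.1 i)
      = ∑ p, g p * spinPair στ p := by
  simp only [Fintype.sum_prod_type, spinPair, mul_assoc]

lemma cavityWeight_eq (N M : ℕ) (β t : ℝ)
    (J : ((Fin M × Fin M) → ℝ) × ((Fin N × Fin M) → ℝ))
    (στ : (Fin N → Bool) × (Fin M → Bool)) :
    cavityWeight N M β t J στ = Real.exp (logXi M β στ.2 J.1
      + Real.sqrt (t / ((N : ℝ) * (M : ℝ))) * ∑ p, J.2 p * spinPair στ p) := by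
  rw [cavityWeight, sum_interaction_eq, logXi]

lemma cavityPsi_eq (N M : ℕ) (β t : ℝ) :
    cavityPsi N M β t = ∫ J, Real.log (∑ στ : (Fin N → Bool) × (Fin M → Bool),
        Real.exp (logXi M β στ.2 J.1
          + Real.sqrt (t / ((N : ℝ) * (M : ℝ))) * ∑ p, J.2 p * spinPair στ p))
        - Real.log (∑ τ : Fin M → Bool, Real.exp (logXi M β τ J.1)) ∂(couplingLaw N M) := by
  rw [cavityPsi]
  congr 1
  ext J
  rw [← Real.log_div (sum_exp_pos _).ne' (sum_exp_pos _).ne', Fintype.sum_prod_type_right]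
  simp only [Real.exp_add, ← Finset.mul_sum, ← sum_interaction_eq, logXi]

lemma sum_replica_two_eq_gibbsAvg_sq {S : Type*} [Fintype S] (w g : S → ℝ) :
    (∑ R : Fin 2 → S, (∏ a, Real.exp (w (R a))) * (g (R 0) * g (R 1)))
      / (∑ s, Real.exp (w s)) ^ 2 = gibbsAvg w g ^ 2 := by
  rw [gibbsAvg, div_pow, sq (∑ s, Real.exp (w s) * g s), Finset.sum_mul_sum,
    ← Fintype.sum_prod_type', Fintype.sum_equiv (piFinTwoEquiv fun _ => S)]
  intro R
  simp only [Fin.prod_univ_two, piFinTwoEquiv_apply]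
  ring

lemma ovlp_mul_ovlp {N M : ℕ} (στ στ' : (Fin N → Bool) × (Fin M → Bool)) :
    ovlp N στ.1 στ'.1 * ovlp M στ.2 στ'.2
      = 1 / ((N : ℝ) * M) * ∑ p, spinPair στ p * spinPair στ' p := by
  rw [ovlp, ovlp, mul_mul_mul_comm, Finset.sum_mul_sum, one_div_mul_one_div,
    Fintype.sum_prod_type]
  simp only [spinPair]
  congr 1
  exact Finset.sum_congr rfl fun i _ => Finset.sum_congr rfl fun k _ => by ring

lemma replicaAvg_ovlp_mul_ovlp (N M : ℕ) (β t : ℝ) :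
    replicaAvg 2 N M β t (fun R => ovlp N (R 0).1 (R 1).1 * ovlp M (R 0).2 (R 1).2)
      = 1 / ((N : ℝ) * M) * ∑ p, ∫ J, gibbsAvg (fun στ => logXi M β στ.2 J.1
          + Real.sqrt (t / ((N : ℝ) * (M : ℝ))) * ∑ p, J.2 p * spinPair στ p)
          (fun στ => spinPair στ p) ^ 2 ∂(couplingLaw N M) := by
  have hint := integrable_gibbsAvg_sq (S := (Fin N → Bool) × (Fin M → Bool))
    (Measure.pi fun _ : Fin M × Fin M => gaussianReal 0 1)
    (fun στ => measurable_logXi M β στ.2) spinPair_mul_self (Real.sqrt (t / ((N : ℝ) * M)))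
  rw [couplingLaw, ← integral_finsetSum _ fun p _ => hint p, ← integral_const_mul,
    replicaAvg, couplingLaw]
  congr 1
  ext J
  simp only [← sum_replica_two_eq_gibbsAvg_sq, ← Finset.sum_div, mul_div_assoc', cavityZ,
    cavityWeight_eq, ovlp_mul_ovlp]
  congr 1
  rw [Finset.sum_comm, Finset.mul_sum]
  refine Finset.sum_congr rfl fun R _ => ?_
  rw [← Finset.mul_sum, mul_left_comm]

end Cavity

/-- For every `t > 0`, `Ψ'(t) = (1/2)(1 − ⟨q₁₂ q̃₁₂⟩_t)`. -/
theorem cavityPsi_hasDerivAt (N M : ℕ) (hN : 1 ≤ N) (hM : 1 ≤ M)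
    (β : ℝ) (hβ : 0 ≤ β) (t : ℝ) (ht : 0 < t) :
    HasDerivAt (cavityPsi N M β)
      ((1 / 2) * (1 - replicaAvg 2 N M β t (fun R =>
        ovlp N (R 0).1 (R 1).1 * ovlp M (R 0).2 (R 1).2)))
      t := by
  have hN' : (0 : ℝ) < N := by exact_mod_cast hN
  have hM' : (0 : ℝ) < M := by exact_mod_cast hM
  have hr : 0 < Real.sqrt (t / ((N : ℝ) * M)) := Real.sqrt_pos.2 (by positivity)
  have hsqrt : HasDerivAt (fun t => Real.sqrt (t / ((N : ℝ) * M)))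
      (1 / ((N : ℝ) * M) / (2 * Real.sqrt (t / ((N : ℝ) * M)))) t :=
    ((hasDerivAt_id t).div_const _).sqrt (by simp only [id]; positivity)
  have hF := hasDerivAt_integral_log_sum_exp
    (S := (Fin N → Bool) × (Fin M → Bool)) (Measure.pi fun _ : Fin M × Fin M => gaussianReal 0 1)
    (fun στ => measurable_logXi M β στ.2) (fun στ => integrable_logXi M β στ.2)
    spinPair_mul_self (integrable_log_sum_exp fun τ => integrable_logXi M β τ)
    (Real.sqrt (t / ((N : ℝ) * M)))
  rw [funext (cavityPsi_eq N M β), replicaAvg_ovlp_mul_ovlp]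
  refine (hF.comp t hsqrt).congr_deriv ?_
  rw [Finset.sum_sub_distrib, ← couplingLaw]
  simp only [Finset.sum_const, Finset.card_univ, Fintype.card_prod, Fintype.card_fin,
    nsmul_eq_mul, Nat.cast_mul, mul_one]
  field_simp
end
end

section
/- For every t > 0, the map t ↦ ⟨q_{12}q̃_{12}q_{34}q̃_{34}⟩_t is differentiable and d/dt ⟨q_{12}q̃_{12}q_{34}q̃_{34}⟩_t = ⟨ 4 q_{12}q̃_{12}q_{23}q̃_{23}q_{34}q̃_{34} + 2 q_{12}²q̃_{12}²q_{34}q̃_{34} − 16 q_{12}q̃_{12}q_{34}q̃_{34}q_{45}q̃_{45} + 10 q_{12}q̃_{12}q_{34}q̃_{34}q_{56}q̃_{56} ⟩_t. -/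
open MeasureTheory ProbabilityTheory Filter

noncomputable section

/-- Product overlap `q_{ab} q̃_{ab}` of two replicas. -/
def qq (N M n : ℕ) (R : Fin n → (Fin N → Bool) × (Fin M → Bool)) (a b : Fin n) : ℝ :=
  ovlp N (R a).1 (R b).1 * ovlp M (R a).2 (R b).2

/-- Gibbs average of `f` over `n` independent replicas with weights `exp (E s)`. -/
def gibbs {S : Type*} [Fintype S] (n : ℕ) (E : S → ℝ) (f : (Fin n → S) → ℝ) : ℝ :=
  (∑ R : Fin n → S, Real.exp (∑ a, E (R a)) * f R) / (∑ s, Real.exp (E s)) ^ n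

namespace gibbs

variable {S : Type*} [Fintype S] {n : ℕ}

lemma sum_exp_pos [Nonempty S] (E : S → ℝ) : 0 < ∑ s, Real.exp (E s) :=
  Finset.sum_pos (fun _ _ => Real.exp_pos _) Finset.univ_nonempty

lemma add (E : S → ℝ) (f g : (Fin n → S) → ℝ) :
    gibbs n E (fun R => f R + g R) = gibbs n E f + gibbs n E g := by
  simp only [gibbs, mul_add, Finset.sum_add_distrib, add_div]

lemma const_mul (E : S → ℝ) (c : ℝ) (f : (Fin n → S) → ℝ) :
    gibbs n E (fun R => c * f R) = c * gibbs n E f := by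
  simp only [gibbs, mul_left_comm _ c, ← Finset.mul_sum, mul_div_assoc]

lemma sum {ι : Type*} (s : Finset ι) (E : S → ℝ) (f : ι → (Fin n → S) → ℝ) :
    gibbs n E (fun R => ∑ p ∈ s, f p R) = ∑ p ∈ s, gibbs n E (f p) := by
  simp only [gibbs, Finset.mul_sum, ← Finset.sum_div]
  rw [Finset.sum_comm]

lemma comp_perm (E : S → ℝ) (e : Equiv.Perm (Fin n)) (f : (Fin n → S) → ℝ) :
    gibbs n E (fun R => f (R ∘ e)) = gibbs n E f := by
  unfold gibbs
  congr 1
  refine Fintype.sum_equiv (Equiv.arrowCongr e.symm (Equiv.refl S)) _ _ fun R => ?_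
  have h : ∑ a, E (R (e a)) = ∑ a, E (R a) := Equiv.sum_comp e fun a => E (R a)
  rw [← h]
  rfl

lemma abs_le [Nonempty S] (E : S → ℝ) (f : (Fin n → S) → ℝ) :
    |gibbs n E f| ≤ ∑ R, |f R| := by
  have hZ := pow_pos (sum_exp_pos E) n
  rw [gibbs, abs_div, abs_of_pos hZ, div_le_iff₀ hZ, Finset.sum_mul]
  refine (Finset.abs_sum_le_sum_abs _ _).trans (Finset.sum_le_sum fun R _ => ?_)
  rw [abs_mul, Real.abs_exp, mul_comm]
  refine mul_le_mul_of_nonneg_left ?_ (abs_nonneg _)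
  calc Real.exp (∑ a, E (R a)) = ∏ a, Real.exp (E (R a)) := Real.exp_sum _ _
    _ ≤ ∏ _a : Fin n, ∑ s, Real.exp (E s) :=
      Finset.prod_le_prod (fun _ _ => (Real.exp_pos _).le) fun a _ =>
        Finset.single_le_sum (f := fun s => Real.exp (E s))
          (fun _ _ => (Real.exp_pos _).le) (Finset.mem_univ (R a))
    _ = _ := by simp

lemma continuous [Nonempty S] (f : (Fin n → S) → ℝ) :
    Continuous fun E : S → ℝ => gibbs n E f := by
  unfold gibbs
  refine Continuous.div (by fun_prop) (by fun_prop) fun E => (pow_pos (sum_exp_pos E) n).ne'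

/-- Multiply an `n`-replica observable by `∑ₐ vₐ − n vₙ₊₁`, which is the effect of
differentiating an `n`-replica Gibbs average along `v`. -/
def deriv (v : S → ℝ) (f : (Fin n → S) → ℝ) (R : Fin (n + 1) → S) : ℝ :=
  f (fun a => R a.castSucc) * (∑ a : Fin n, v (R a.castSucc) - n * v (R (Fin.last n)))

lemma deriv_sum_mul {S ι : Type*} (s : Finset ι) (c : ι → ℝ) (v : ι → S → ℝ)
    (f : (Fin n → S) → ℝ) (R : Fin (n + 1) → S) :
    deriv (fun x => ∑ p ∈ s, c p * v p x) f R = ∑ p ∈ s, c p * deriv (v p) f R := by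
  simp only [deriv]
  rw [Finset.sum_comm, Finset.mul_sum, ← Finset.sum_sub_distrib, Finset.mul_sum]
  refine Finset.sum_congr rfl fun p _ => ?_
  rw [← Finset.mul_sum]
  ring

lemma hasDerivAt [Nonempty S] {E : ℝ → S → ℝ} {v : S → ℝ} {x : ℝ}
    (hE : ∀ s, HasDerivAt (fun y => E y s) (v s) x) (f : (Fin n → S) → ℝ) :
    HasDerivAt (fun y => gibbs n (E y) f) (gibbs (n + 1) (E x) (deriv v f)) x := by
  have hA : HasDerivAt (fun y => ∑ R : Fin n → S, Real.exp (∑ a, E y (R a)) * f R)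
      (∑ R : Fin n → S, Real.exp (∑ a, E x (R a)) * (∑ a, v (R a)) * f R) x :=
    HasDerivAt.fun_sum fun R _ =>
      ((HasDerivAt.fun_sum fun a _ => hE (R a)).exp).mul_const _
  have hZ : HasDerivAt (fun y => ∑ s, Real.exp (E y s)) (∑ s, Real.exp (E x s) * v s) x :=
    HasDerivAt.fun_sum fun s _ => (hE s).exp
  have hpos := sum_exp_pos (E x)
  have key : ∑ R : Fin (n + 1) → S, Real.exp (∑ a, E x (R a)) * deriv v f R =
      (∑ R : Fin n → S, Real.exp (∑ a, E x (R a)) * (∑ a, v (R a)) * f R) *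
          ∑ s, Real.exp (E x s)
        - n * ((∑ R : Fin n → S, Real.exp (∑ a, E x (R a)) * f R) *
          ∑ s, Real.exp (E x s) * v s) := by
    rw [← (Fin.snocEquiv fun _ : Fin (n + 1) => S).sum_comp, Fintype.sum_prod_type_right,
      Finset.sum_mul, Finset.sum_mul, Finset.mul_sum, ← Finset.sum_sub_distrib]
    refine Finset.sum_congr rfl fun R _ => ?_
    rw [Finset.mul_sum _ _ (_ * f R), Finset.mul_sum _ _ (_ * f R),
      Finset.mul_sum _ _ (n : ℝ), ← Finset.sum_sub_distrib]
    refine Finset.sum_congr rfl fun s _ => ?_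
    simp only [Fin.snocEquiv, Equiv.coe_fn_mk, deriv, Fin.sum_univ_castSucc, Fin.snoc_castSucc,
      Fin.snoc_last, Real.exp_add]
    ring
  convert! hA.div (hZ.fun_pow n) (pow_pos hpos n).ne' using 1
  rw [gibbs, key]
  rcases n with _ | n
  · simp
  · simp only [Nat.add_sub_cancel]
    field_simp
    ring

end gibbs

/-- Gaussian integration by parts on the line. -/
lemma integral_id_mul_gaussianReal_s15 {f f' : ℝ → ℝ} {C C' : ℝ}
    (hf : ∀ x, HasDerivAt f (f' x) x) (hC : ∀ x, |f x| ≤ C) (hC' : ∀ x, |f' x| ≤ C') :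
    ∫ x, x * f x ∂(gaussianReal 0 1) = ∫ x, f' x ∂(gaussianReal 0 1) := by
  have hg : ∀ x, HasDerivAt (gaussianPDFReal 0 1) (-x * gaussianPDFReal 0 1 x) x := by
    intro x
    have h : HasDerivAt (fun y : ℝ => -(y - 0) ^ 2 / (2 * ((1 : NNReal) : ℝ))) (-x) x := by
      have := (((hasDerivAt_id x).sub_const 0).pow 2).neg.div_const (2 * ((1 : NNReal) : ℝ))
      convert! this using 1
      simp; ring
    convert! h.exp.const_mul _ using 1
    rw [gaussianPDFReal]
    ring
  have hfm : AEStronglyMeasurable f volume :=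
    (continuous_iff_continuousAt.2 fun x => (hf x).continuousAt).aestronglyMeasurable
  have hf'm : AEStronglyMeasurable f' volume := by
    rw [← funext fun x => (hf x).deriv]
    exact (measurable_deriv f).aestronglyMeasurable
  have hgi := integrable_gaussianPDFReal 0 1
  have hxg : Integrable (fun x => -x * gaussianPDFReal 0 1 x) := by
    have := (memLp_id_gaussianReal (μ := 0) (v := 1) 1).integrable (by norm_num)
    rw [gaussianReal_of_var_ne_zero _ one_ne_zero, integrable_withDensity_iff
      (measurable_gaussianPDF 0 1) (ae_of_all _ fun x => gaussianPDF_lt_top)] at this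
    simpa [toReal_gaussianPDF] using this.neg
  have h := integral_mul_deriv_eq_deriv_mul_of_integrable (u := f) (v := gaussianPDFReal 0 1)
    (fun x _ => hf x) (fun x _ => hg x)
    (hxg.bdd_mul hfm (ae_of_all _ hC)) (hgi.bdd_mul hf'm (ae_of_all _ hC'))
    (hgi.bdd_mul hfm (ae_of_all _ hC))
  simp only [integral_gaussianReal_eq_integral_smul one_ne_zero, smul_eq_mul]
  calc _ = -∫ x, f x * (-x * gaussianPDFReal 0 1 x) := by
        rw [← integral_neg]; congr 1; ext x; ring
    _ = _ := by rw [h, neg_neg]; congr 1; ext x; ring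

/-- Resampling one coordinate of the second, product, factor preserves the law. -/
lemma measurePreserving_update_snd {X ι : Type*} [MeasurableSpace X] [Fintype ι] [DecidableEq ι]
    (μ : Measure X) [IsProbabilityMeasure μ] (γ : Measure ℝ) [IsProbabilityMeasure γ] (p : ι) :
    MeasurePreserving (fun z : (X × (ι → ℝ)) × ℝ => (z.1.1, Function.update z.1.2 p z.2))
      ((μ.prod (Measure.pi fun _ : ι => γ)).prod γ) (μ.prod (Measure.pi fun _ : ι => γ)) := by
  have hm : Measurable fun z : (ι → ℝ) × ℝ => Function.update z.1 p z.2 := by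
    refine measurable_pi_lambda _ fun i => ?_
    by_cases h : i = p
    · subst h; simpa using measurable_snd
    · simp only [Function.update_of_ne h]; exact (measurable_pi_apply i).comp measurable_fst
  have h : MeasurePreserving (fun z : (ι → ℝ) × ℝ => Function.update z.1 p z.2)
      ((Measure.pi fun _ : ι => γ).prod γ) (Measure.pi fun _ : ι => γ) := by
    refine ⟨hm, (Measure.pi_eq fun s hs => ?_).symm⟩
    rw [Measure.map_apply hm (MeasurableSet.univ_pi hs)]
    have : (fun z : (ι → ℝ) × ℝ => Function.update z.1 p z.2) ⁻¹' (Set.univ.pi s) =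
        (Set.univ.pi (Function.update s p Set.univ)) ×ˢ s p := by
      ext z
      simp only [Set.mem_preimage, Set.mem_pi, Set.mem_univ, true_imp_iff, Set.mem_prod]
      constructor
      · intro hz
        refine ⟨fun i => ?_, by simpa using hz p⟩
        by_cases hi : i = p
        · subst hi; simp
        · simpa [hi] using hz i
      · rintro ⟨h1, h2⟩ i
        by_cases hi : i = p
        · subst hi; simpa using h2
        · simpa [hi] using h1 i
    rw [this, Measure.prod_prod, Measure.pi_pi, ← Finset.mul_prod_erase _ _ (Finset.mem_univ p),
      ← Finset.mul_prod_erase (a := p) _ (fun i => γ (s i)) (Finset.mem_univ p)]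
    simp only [Function.update_self, measure_univ, one_mul]
    rw [mul_comm]
    congr 1
    exact Finset.prod_congr rfl fun i hi => by
      rw [Function.update_of_ne (Finset.ne_of_mem_erase hi)]
  exact ((MeasurePreserving.id μ).prod h).comp (measurePreserving_prodAssoc _ _ _)

/-- Gaussian integration by parts in one coordinate of the second factor. -/
lemma integral_coord_mul {X ι : Type*} [MeasurableSpace X] [Fintype ι] [DecidableEq ι]
    (μ : Measure X) [IsProbabilityMeasure μ] (p : ι) {G G' : X × (ι → ℝ) → ℝ} {C C' : ℝ}
    (hG : Measurable G) (hG' : Measurable G')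
    (hd : ∀ (J : X × (ι → ℝ)) (x : ℝ), HasDerivAt
      (fun y => G (J.1, Function.update J.2 p y)) (G' (J.1, Function.update J.2 p x)) x)
    (hC : ∀ J, |G J| ≤ C) (hC' : ∀ J, |G' J| ≤ C') :
    ∫ J, J.2 p * G J ∂(μ.prod (Measure.pi fun _ : ι => gaussianReal 0 1)) =
      ∫ J, G' J ∂(μ.prod (Measure.pi fun _ : ι => gaussianReal 0 1)) := by
  have hmp := measurePreserving_update_snd μ (gaussianReal 0 1) p
  have hid : Integrable (fun x : ℝ => x) (gaussianReal 0 1) :=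
    (memLp_id_gaussianReal (μ := 0) (v := 1) 1).integrable (by norm_num)
  have hm1 : Measurable fun J : X × (ι → ℝ) => J.2 p * G J :=
    ((measurable_pi_apply p).comp measurable_snd).mul hG
  have hi1 : Integrable (fun z : (X × (ι → ℝ)) × ℝ =>
      z.2 * G (z.1.1, Function.update z.1.2 p z.2))
      ((μ.prod (Measure.pi fun _ : ι => gaussianReal 0 1)).prod (gaussianReal 0 1)) :=
    (hid.comp_snd _).mul_bdd (hG.comp hmp.measurable).aestronglyMeasurable
      (ae_of_all _ fun z => hC _)
  have hi2 : Integrable (fun z : (X × (ι → ℝ)) × ℝ =>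
      G' (z.1.1, Function.update z.1.2 p z.2))
      ((μ.prod (Measure.pi fun _ : ι => gaussianReal 0 1)).prod (gaussianReal 0 1)) :=
    Integrable.of_bound (hG'.comp hmp.measurable).aestronglyMeasurable C'
      (ae_of_all _ fun z => hC' _)
  rw [← hmp.map_eq, integral_map hmp.aemeasurable hm1.aestronglyMeasurable,
    integral_map hmp.aemeasurable hG'.aestronglyMeasurable]
  simp only [Function.update_self]
  rw [integral_prod _ hi1, integral_prod _ hi2]
  congr 1
  ext J
  exact integral_id_mul_gaussianReal_s15 (hd J) (fun x => hC _) fun x => hC' _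

section LinearField

variable {X ι S : Type*} [Fintype ι]

/-- Energy with a background part depending on the first factor of the disorder and a part
linear, with coupling `c`, in its second factor. -/
def linearField (E₀ : X → S → ℝ) (e : ι → S → ℝ) (c : ℝ) (J : X × (ι → ℝ)) (s : S) : ℝ :=
  E₀ J.1 s + c * ∑ p, J.2 p * e p s

variable [MeasurableSpace X] [Fintype S] [Nonempty S] {n : ℕ}

lemma measurable_gibbs_linearField {E₀ : X → S → ℝ} (hE₀ : ∀ s, Measurable fun x => E₀ x s)
    (e : ι → S → ℝ) (c : ℝ) (f : (Fin n → S) → ℝ) :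
    Measurable fun J => gibbs n (linearField E₀ e c J) f := by
  refine (gibbs.continuous f).measurable.comp (measurable_pi_lambda _ fun s => ?_)
  refine ((hE₀ s).comp measurable_fst).add (Measurable.const_mul ?_ c)
  exact Finset.measurable_fun_sum _ fun p _ =>
    ((measurable_pi_apply p).comp measurable_snd).mul_const _

variable (μ : Measure X) [IsProbabilityMeasure μ]

lemma integrable_gibbs_linearField {E₀ : X → S → ℝ} (hE₀ : ∀ s, Measurable fun x => E₀ x s)
    (e : ι → S → ℝ) (c : ℝ) (f : (Fin n → S) → ℝ) :
    Integrable (fun J => gibbs n (linearField E₀ e c J) f)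
      (μ.prod (Measure.pi fun _ : ι => gaussianReal 0 1)) :=
  Integrable.of_bound (measurable_gibbs_linearField hE₀ e c f).aestronglyMeasurable _
    (ae_of_all _ fun _ => gibbs.abs_le _ f)

lemma integrable_coord (p : ι) :
    Integrable (fun J : X × (ι → ℝ) => J.2 p)
      (μ.prod (Measure.pi fun _ : ι => gaussianReal 0 1)) := by
  have hid : Integrable (fun x : ℝ => x) (gaussianReal 0 1) :=
    (memLp_id_gaussianReal (μ := 0) (v := 1) 1).integrable (by norm_num)
  exact (integrable_comp_eval (μ := fun _ : ι => gaussianReal 0 1) (i := p) hid).comp_snd μ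

lemma integral_coord_mul_gibbs {E₀ : X → S → ℝ} (hE₀ : ∀ s, Measurable fun x => E₀ x s)
    (e : ι → S → ℝ) (c : ℝ) (p : ι) (f : (Fin n → S) → ℝ) :
    ∫ J, J.2 p * gibbs n (linearField E₀ e c J) f
        ∂(μ.prod (Measure.pi fun _ : ι => gaussianReal 0 1)) =
      c * ∫ J, gibbs (n + 1) (linearField E₀ e c J) (gibbs.deriv (e p) f)
        ∂(μ.prod (Measure.pi fun _ : ι => gaussianReal 0 1)) := by
  classical
  have hderiv : gibbs.deriv (fun s => c * e p s) f = fun R => c * gibbs.deriv (e p) f R := by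
    ext R
    simp only [gibbs.deriv, ← Finset.mul_sum]
    ring
  rw [integral_coord_mul μ p (measurable_gibbs_linearField hE₀ e c f)
    (measurable_gibbs_linearField hE₀ e c (gibbs.deriv (fun s => c * e p s) f)) ?_
    (fun J => gibbs.abs_le _ f) fun J => gibbs.abs_le _ _]
  · simp only [hderiv, gibbs.const_mul]
    exact integral_const_mul _ _
  · intro J x
    refine gibbs.hasDerivAt (fun s => ?_) f
    have h : HasDerivAt (fun y => ∑ q, Function.update J.2 p y q * e q s)
        (∑ q, (Pi.single p (1 : ℝ) : ι → ℝ) q * e q s) x :=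
      HasDerivAt.fun_sum fun q _ =>
        ((hasDerivAt_pi.1 (hasDerivAt_update J.2 p x)) q).mul_const _
    have hsum : ∑ q, (Pi.single p (1 : ℝ) : ι → ℝ) q * e q s = e p s := by
      simp [Pi.single_apply]
    rw [hsum] at h
    simp only [linearField]
    exact (h.const_mul c).const_add _

/-- The derivative in the coupling of a quenched replica average under a linear Gaussian field. -/
lemma hasDerivAt_integral_gibbs {E₀ : X → S → ℝ} (hE₀ : ∀ s, Measurable fun x => E₀ x s)
    (e : ι → S → ℝ) (c : ℝ) (f : (Fin n → S) → ℝ) :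
    HasDerivAt (fun c => ∫ J, gibbs n (linearField E₀ e c J) f
        ∂(μ.prod (Measure.pi fun _ : ι => gaussianReal 0 1)))
      (c * ∫ J, gibbs (n + 2) (linearField E₀ e c J)
          (fun R => ∑ p, gibbs.deriv (e p) (gibbs.deriv (e p) f) R)
        ∂(μ.prod (Measure.pi fun _ : ι => gaussianReal 0 1))) c := by
  let F' (c : ℝ) (J : X × (ι → ℝ)) : ℝ :=
    ∑ p, J.2 p * gibbs (n + 1) (linearField E₀ e c J) (gibbs.deriv (e p) f)
  have hF' (c : ℝ) (J : X × (ι → ℝ)) : gibbs (n + 1) (linearField E₀ e c J)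
      (gibbs.deriv (fun s => ∑ p, J.2 p * e p s) f) = F' c J := by
    simp only [F', ← gibbs.const_mul, ← gibbs.sum]
    congr 1
    ext R
    exact gibbs.deriv_sum_mul _ _ _ _ _
  have hterm (c : ℝ) (p : ι) : Integrable (fun J : X × (ι → ℝ) =>
      J.2 p * gibbs (n + 1) (linearField E₀ e c J) (gibbs.deriv (e p) f))
      (μ.prod (Measure.pi fun _ : ι => gaussianReal 0 1)) :=
    (integrable_coord μ p).mul_bdd
      (measurable_gibbs_linearField hE₀ e c _).aestronglyMeasurable
      (ae_of_all _ fun _ => gibbs.abs_le _ _)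
  have hmain := (hasDerivAt_integral_of_dominated_loc_of_deriv_le (F' := F') (x₀ := c)
    (bound := fun J => ∑ p, |J.2 p| * ∑ R, |gibbs.deriv (e p) f R|) Filter.univ_mem
    (Filter.Eventually.of_forall fun c =>
      (measurable_gibbs_linearField hE₀ e c f).aestronglyMeasurable)
    (integrable_gibbs_linearField μ hE₀ e c f)
    (integrable_finsetSum _ fun p _ => hterm c p).aestronglyMeasurable
    (ae_of_all _ fun J c _ => ?_)
    (integrable_finsetSum _ fun p _ => (integrable_coord μ p).abs.mul_const _)
    (ae_of_all _ fun J c _ => ?_)).2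
  · refine hmain.congr_deriv ?_
    simp only [gibbs.sum]
    rw [integral_finsetSum _ fun p _ => integrable_gibbs_linearField μ hE₀ e c _,
      integral_finsetSum _ fun p _ => hterm c p, Finset.mul_sum]
    exact Finset.sum_congr rfl fun p _ => integral_coord_mul_gibbs μ hE₀ e c p _
  · refine (Finset.abs_sum_le_sum_abs _ _).trans (Finset.sum_le_sum fun p _ => ?_)
    rw [abs_mul]
    exact mul_le_mul_of_nonneg_left (gibbs.abs_le _ _) (abs_nonneg _)
  · rw [← hF']
    refine gibbs.hasDerivAt (fun s => ?_) f
    simpa [linearField] using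
      ((hasDerivAt_id c).mul_const (∑ p, J.2 p * e p s)).const_add (E₀ J.1 s)

end LinearField

/-- Exponent of the random weight `ξ_τ`. -/
def backgroundEnergy (N M : ℕ) (β : ℝ) (J : (Fin M × Fin M) → ℝ)
    (s : (Fin N → Bool) × (Fin M → Bool)) : ℝ :=
  (β / Real.sqrt M) * ∑ k : Fin M, ∑ l : Fin M, J (k, l) * spinval (s.2 k) * spinval (s.2 l)

/-- The product `τ_k σ_i` multiplying the coupling `J̃_{ik}`. -/
def interaction (N M : ℕ) (p : Fin N × Fin M) (s : (Fin N → Bool) × (Fin M → Bool)) : ℝ :=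
  spinval (s.2 p.2) * spinval (s.1 p.1)

lemma measurable_backgroundEnergy (N M : ℕ) (β : ℝ) (s : (Fin N → Bool) × (Fin M → Bool)) :
    Measurable fun J => backgroundEnergy N M β J s := by
  unfold backgroundEnergy
  fun_prop

lemma replicaAvg_eq_integral_gibbs (n N M : ℕ) (β t : ℝ)
    (f : (Fin n → (Fin N → Bool) × (Fin M → Bool)) → ℝ) :
    replicaAvg n N M β t f =
      ∫ J, gibbs n (linearField (backgroundEnergy N M β) (interaction N M)
        (√(t / ((N : ℝ) * M))) J) f
        ∂((Measure.pi fun _ : Fin M × Fin M => gaussianReal 0 1).prod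
          (Measure.pi fun _ : Fin N × Fin M => gaussianReal 0 1)) := by
  have h (J : ((Fin M × Fin M) → ℝ) × ((Fin N × Fin M) → ℝ))
      (s : (Fin N → Bool) × (Fin M → Bool)) : cavityWeight N M β t J s =
      Real.exp (linearField (backgroundEnergy N M β) (interaction N M)
        (√(t / ((N : ℝ) * M))) J s) := by
    simp only [cavityWeight, linearField, backgroundEnergy, interaction, Fintype.sum_prod_type,
      mul_assoc]
  simp only [replicaAvg, cavityZ, couplingLaw, gibbs, h, Real.exp_sum]

lemma ovlp_comm (N : ℕ) (σ σ' : Fin N → Bool) : ovlp N σ σ' = ovlp N σ' σ := by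
  rw [ovlp, ovlp]
  simp_rw [fun i => mul_comm (spinval (σ i)) (spinval (σ' i))]

lemma ovlp_self {N : ℕ} (hN : 1 ≤ N) (σ : Fin N → Bool) : ovlp N σ σ = 1 := by
  have h (b : Bool) : spinval b * spinval b = 1 := by cases b <;> simp [spinval]
  have : (N : ℝ) ≠ 0 := by positivity
  simp [ovlp, h, this]

lemma qq_comm {N M n : ℕ} (R : Fin n → (Fin N → Bool) × (Fin M → Bool)) (a b : Fin n) :
    qq N M n R a b = qq N M n R b a := by
  rw [qq, qq, ovlp_comm N, ovlp_comm M]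

lemma qq_self {N M n : ℕ} (hN : 1 ≤ N) (hM : 1 ≤ M)
    (R : Fin n → (Fin N → Bool) × (Fin M → Bool)) (a : Fin n) : qq N M n R a a = 1 := by
  rw [qq, ovlp_self hN, ovlp_self hM, one_mul]

lemma sum_interaction_mul {N M n : ℕ} (hN : 1 ≤ N) (hM : 1 ≤ M)
    (R : Fin n → (Fin N → Bool) × (Fin M → Bool)) (a b : Fin n) :
    ∑ p, interaction N M p (R a) * interaction N M p (R b) = N * M * qq N M n R a b := by
  have hN' : (N : ℝ) ≠ 0 := by positivity
  have hM' : (M : ℝ) ≠ 0 := by positivity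
  have h : ∑ p, interaction N M p (R a) * interaction N M p (R b) =
      (∑ i, spinval ((R a).1 i) * spinval ((R b).1 i)) *
        ∑ k, spinval ((R a).2 k) * spinval ((R b).2 k) := by
    rw [Finset.sum_mul_sum, Fintype.sum_prod_type]
    exact Finset.sum_congr rfl fun i _ => Finset.sum_congr rfl fun k _ => by
      simp only [interaction]; ring
  rw [h, qq, ovlp, ovlp]
  field_simp

/-- The second-order effect on `q₁₂q̃₁₂q₃₄q̃₃₄` of all the couplings, before replicas are
relabelled. -/
lemma sum_deriv_deriv_qq_mul_qq {N M : ℕ} (hN : 1 ≤ N) (hM : 1 ≤ M)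
    (R : Fin 6 → (Fin N → Bool) × (Fin M → Bool)) :
    ∑ p, gibbs.deriv (interaction N M p) (gibbs.deriv (interaction N M p)
        fun R => qq N M 4 R 0 1 * qq N M 4 R 2 3) R =
      2 * N * M * (qq N M 6 R 0 1 * qq N M 6 R 2 3 *
        (qq N M 6 R 0 1 + qq N M 6 R 0 2 + qq N M 6 R 0 3 + qq N M 6 R 1 2 + qq N M 6 R 1 3
          + qq N M 6 R 2 3
          - 3 / 2 * (qq N M 6 R 0 4 + qq N M 6 R 1 4 + qq N M 6 R 2 4 + qq N M 6 R 3 4)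
          - 5 / 2 * (qq N M 6 R 0 5 + qq N M 6 R 1 5 + qq N M 6 R 2 5 + qq N M 6 R 3 5)
          + 10 * qq N M 6 R 4 5)) := by
  have hS := sum_interaction_mul hN hM R
  have hexp : ∀ p, gibbs.deriv (interaction N M p) (gibbs.deriv (interaction N M p)
        fun R => qq N M 4 R 0 1 * qq N M 4 R 2 3) R =
      qq N M 6 R 0 1 * qq N M 6 R 2 3 *
        ((interaction N M p (R 0) + interaction N M p (R 1) + interaction N M p (R 2)
            + interaction N M p (R 3) - 4 * interaction N M p (R 4)) *
          (interaction N M p (R 0) + interaction N M p (R 1) + interaction N M p (R 2)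
            + interaction N M p (R 3) + interaction N M p (R 4)
            - 5 * interaction N M p (R 5))) := by
    intro p
    have h4 : ∑ a : Fin 4, interaction N M p (R a.castSucc.castSucc) =
        interaction N M p (R 0) + interaction N M p (R 1) + interaction N M p (R 2)
            + interaction N M p (R 3) := Fin.sum_univ_four _
    have h5 : ∑ a : Fin 5, interaction N M p (R a.castSucc) =
        interaction N M p (R 0) + interaction N M p (R 1) + interaction N M p (R 2)
            + interaction N M p (R 3) + interaction N M p (R 4) := Fin.sum_univ_five _
    simp only [gibbs.deriv, h4, h5]
    rw [mul_assoc]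
    rfl
  have hself := qq_self hN hM R
  simp only [hexp, ← Finset.mul_sum]
  have hquad : ∑ p, ((interaction N M p (R 0) + interaction N M p (R 1) + interaction N M p (R 2)
            + interaction N M p (R 3) - 4 * interaction N M p (R 4)) *
          (interaction N M p (R 0) + interaction N M p (R 1) + interaction N M p (R 2)
            + interaction N M p (R 3) + interaction N M p (R 4)
            - 5 * interaction N M p (R 5))) =
      N * M * (qq N M 6 R 0 0 + qq N M 6 R 1 1 + qq N M 6 R 2 2 + qq N M 6 R 3 3
        - 4 * qq N M 6 R 4 4
        + 2 * (qq N M 6 R 0 1 + qq N M 6 R 0 2 + qq N M 6 R 0 3 + qq N M 6 R 1 2 + qq N M 6 R 1 3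
          + qq N M 6 R 2 3)
        - 3 * (qq N M 6 R 0 4 + qq N M 6 R 1 4 + qq N M 6 R 2 4 + qq N M 6 R 3 4)
        - 5 * (qq N M 6 R 0 5 + qq N M 6 R 1 5 + qq N M 6 R 2 5 + qq N M 6 R 3 5)
        + 20 * qq N M 6 R 4 5) := by
    simp only [mul_add, mul_sub, mul_left_comm _ (2 : ℝ), mul_left_comm _ (3 : ℝ),
      mul_left_comm _ (4 : ℝ), mul_left_comm _ (5 : ℝ), mul_left_comm _ (20 : ℝ), ← hS]
    simp only [Finset.mul_sum, ← Finset.sum_add_distrib, ← Finset.sum_sub_distrib]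
    exact Finset.sum_congr rfl fun p _ => by ring
  rw [hquad]
  simp only [hself]
  ring

/-- Relabelling the six replicas by `e`. -/
lemma gibbs_qq_mul_qq_mul_qq_perm {N M : ℕ} (E : (Fin N → Bool) × (Fin M → Bool) → ℝ)
    (e : Equiv.Perm (Fin 6)) (a b : Fin 6) :
    gibbs 6 E (fun R => qq N M 6 R 0 1 * qq N M 6 R 2 3 * qq N M 6 R a b) =
      gibbs 6 E (fun R => qq N M 6 R (e 0) (e 1) * qq N M 6 R (e 2) (e 3) *
        qq N M 6 R (e a) (e b)) :=
  (gibbs.comp_perm E e fun R => qq N M 6 R 0 1 * qq N M 6 R 2 3 * qq N M 6 R a b).symm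

lemma gibbs_sum_deriv_deriv_qq_mul_qq {N M : ℕ} (hN : 1 ≤ N) (hM : 1 ≤ M)
    (E : (Fin N → Bool) × (Fin M → Bool) → ℝ) :
    gibbs 6 E (fun R => ∑ p, gibbs.deriv (interaction N M p) (gibbs.deriv (interaction N M p)
        fun R => qq N M 4 R 0 1 * qq N M 4 R 2 3) R) =
      2 * N * M * gibbs 6 E (fun R =>
        4 * (qq N M 6 R 0 1 * qq N M 6 R 1 2 * qq N M 6 R 2 3)
        + 2 * ((qq N M 6 R 0 1) ^ 2 * qq N M 6 R 2 3)
        - 16 * (qq N M 6 R 0 1 * qq N M 6 R 2 3 * qq N M 6 R 3 4)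
        + 10 * (qq N M 6 R 0 1 * qq N M 6 R 2 3 * qq N M 6 R 4 5)) := by
  let g (a b : Fin 6) : ℝ :=
    gibbs 6 E (fun R => qq N M 6 R 0 1 * qq N M 6 R 2 3 * qq N M 6 R a b)
  have hL : gibbs 6 E (fun R => ∑ p, gibbs.deriv (interaction N M p)
        (gibbs.deriv (interaction N M p) fun R => qq N M 4 R 0 1 * qq N M 4 R 2 3) R) =
      2 * N * M * (g 0 1 + g 0 2 + g 0 3 + g 1 2 + g 1 3 + g 2 3
        + (-3 / 2) * (g 0 4 + g 1 4 + g 2 4 + g 3 4)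
        + (-5 / 2) * (g 0 5 + g 1 5 + g 2 5 + g 3 5) + 10 * g 4 5) := by
    simp only [g, sum_deriv_deriv_qq_mul_qq hN hM, ← gibbs.add, ← gibbs.const_mul]
    congr 1
    ext R
    ring
  have hR : gibbs 6 E (fun R => 4 * (qq N M 6 R 0 1 * qq N M 6 R 1 2 * qq N M 6 R 2 3)
        + 2 * ((qq N M 6 R 0 1) ^ 2 * qq N M 6 R 2 3)
        - 16 * (qq N M 6 R 0 1 * qq N M 6 R 2 3 * qq N M 6 R 3 4)
        + 10 * (qq N M 6 R 0 1 * qq N M 6 R 2 3 * qq N M 6 R 4 5)) =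
      4 * g 1 2 + 2 * g 0 1 + (-16) * g 3 4 + 10 * g 4 5 := by
    simp only [g, ← gibbs.add, ← gibbs.const_mul]
    congr 1
    ext R
    ring
  have hg (e : Equiv.Perm (Fin 6)) (a b : Fin 6)
      (he : (e 0 = 0 ∨ e 0 = 1) ∧ (e 1 = 0 ∨ e 1 = 1) ∧ (e 2 = 2 ∨ e 2 = 3) ∧
        (e 3 = 2 ∨ e 3 = 3) ∨ (e 0 = 2 ∨ e 0 = 3) ∧ (e 1 = 2 ∨ e 1 = 3) ∧
        (e 2 = 0 ∨ e 2 = 1) ∧ (e 3 = 0 ∨ e 3 = 1)) : g a b = g (e a) (e b) := by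
    have h01 : e 0 ≠ e 1 := by simp
    have h23 : e 2 ≠ e 3 := by simp
    simp only [g]
    rw [gibbs_qq_mul_qq_mul_qq_perm E e a b]
    congr 1
    ext R
    have c10 := qq_comm R 1 0
    have c32 := qq_comm R 3 2
    rcases he with ⟨h0 | h0, h1 | h1, h2 | h2, h3 | h3⟩ | ⟨h0 | h0, h1 | h1, h2 | h2, h3 | h3⟩ <;>
      simp_all <;> grind
  have hcomm (a b : Fin 6) : g a b = g b a := by
    simp only [g, qq_comm _ a b]
  let s01 : Equiv.Perm (Fin 6) := Equiv.swap 0 1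
  let s23 : Equiv.Perm (Fin 6) := Equiv.swap 2 3
  let s45 : Equiv.Perm (Fin 6) := Equiv.swap 4 5
  let s : Equiv.Perm (Fin 6) := Equiv.swap 0 2 * Equiv.swap 1 3
  have e23 : g 2 3 = g 0 1 := hg s 2 3 (by decide)
  have e02 : g 0 2 = g 1 2 := hg s01 0 2 (by decide)
  have e13 : g 1 3 = g 1 2 := hg s23 1 3 (by decide)
  have e03 : g 0 3 = g 1 3 := hg s01 0 3 (by decide)
  have e24 : g 2 4 = g 3 4 := hg s23 2 4 (by decide)
  have e14 : g 1 4 = g 3 4 := hg s 1 4 (by decide)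
  have e04 : g 0 4 = g 1 4 := hg s01 0 4 (by decide)
  have e05 : g 0 5 = g 0 4 := hg s45 0 5 (by decide)
  have e15 : g 1 5 = g 1 4 := hg s45 1 5 (by decide)
  have e25 : g 2 5 = g 2 4 := hg s45 2 5 (by decide)
  have e35 : g 3 5 = g 3 4 := hg s45 3 5 (by decide)
  rw [hL, hR, e05, e15, e25, e35, e04, e14, e24, e03, e13, e02, e23]
  ring

/-- `d/dt ⟨q₁₂q̃₁₂q₃₄q̃₃₄⟩_t = ⟨4 q₁₂q̃₁₂q₂₃q̃₂₃q₃₄q̃₃₄ + 2 q₁₂²q̃₁₂²q₃₄q̃₃₄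
− 16 q₁₂q̃₁₂q₃₄q̃₃₄q₄₅q̃₄₅ + 10 q₁₂q̃₁₂q₃₄q̃₃₄q₅₆q̃₅₆⟩_t`. -/
theorem streaming_q12q34 (N M : ℕ) (hN : 1 ≤ N) (hM : 1 ≤ M)
    (β : ℝ) (hβ : 0 ≤ β) (t : ℝ) (ht : 0 < t) :
    HasDerivAt
      (fun t' => replicaAvg 4 N M β t' (fun R => qq N M 4 R 0 1 * qq N M 4 R 2 3))
      (replicaAvg 6 N M β t (fun R =>
        4 * (qq N M 6 R 0 1 * qq N M 6 R 1 2 * qq N M 6 R 2 3)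
        + 2 * ((qq N M 6 R 0 1) ^ 2 * qq N M 6 R 2 3)
        - 16 * (qq N M 6 R 0 1 * qq N M 6 R 2 3 * qq N M 6 R 3 4)
        + 10 * (qq N M 6 R 0 1 * qq N M 6 R 2 3 * qq N M 6 R 4 5)))
      t := by
  have hc : HasDerivAt (fun t' => √(t' / ((N : ℝ) * M)))
      (1 / (N * M) / (2 * √(t / ((N : ℝ) * M)))) t := by
    have hpos : 0 < t / ((N : ℝ) * M) := by positivity
    exact ((hasDerivAt_id t).div_const _).sqrt hpos.ne'
  simp only [replicaAvg_eq_integral_gibbs]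
  refine ((hasDerivAt_integral_gibbs _ (measurable_backgroundEnergy N M β) (interaction N M) _
    _).comp t hc).congr_deriv ?_
  have hs : √(t / ((N : ℝ) * M)) ≠ 0 := by positivity
  rw [mul_right_comm, ← integral_const_mul]
  congr 1
  ext J
  rw [gibbs_sum_deriv_deriv_qq_mul_qq hN hM, ← mul_assoc]
  convert one_mul _ using 2
  field_simp
end
end
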